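/- Let N_max ≥ 1 be an integer and let A_1, …, A_5 : {1,…,N_max} → ℝ, with p_1,…,p_5 ≥ 0, ∑_{i=1}^5 p_i = 1. For N_1, N_2 ∈ {1,…,N_max} write Δ_i(N_1,N_2) = A_i(N_2) − A_i(N_1), and let A_𝒟(N) = ∑_{i=1}^5 p_i A_i(N). Let N* ∈ {1,…,N_max} and assume: (i) Δ_1(N,N*) = Δ_2(N,N*) = Δ_5(N,N*) = 0 for all N ≤ N*; (ii) −Δ_3(N,N*) > 0 and Δ_4(N,N*) > 0 for all N < N*. Define δ = inf_{1 ≤ N < N*} Δ_4(N,N*) / (−Δ_3(N,N*)) and assume δ > 0. Let N_𝒟 = min(argmax_{N ∈ {1,…,N_max}} A_𝒟(N)), and let N*_1 = N*_2 = 1, N*_4 = N*, and N*_3, N*_5 ∈ [1, N_max] be real numbers with κ := N*_3 + N*_5 − 1. Then ( ∑_{i=1}^5 p_i N*_i ) / N_𝒟 ≤ φ(p_4), where φ(p_4) = ( κ + p_4 (N* − κ) ) / ( 1 + (N* − 1)·𝟙{ p_4 δ > 1 − p_4 } ). -/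

import Mathlib

/-- Overscaling upper bound: under the five-type structure, the ratio of the average
sample-optimal parallelism level to the smallest system-optimal parallelism level `N_𝒟`
is bounded by `φ(p₄) = (κ + p₄(N* − κ)) / (1 + (N* − 1)·𝟙{p₄δ > 1 − p₄})`. -/
theorem stmt3 (Nmax : ℕ) (hNmax : 1 ≤ Nmax)
    (A1 A2 A3 A4 A5 : ℕ → ℝ) (p1 p2 p3 p4 p5 : ℝ)
    (hp1 : 0 ≤ p1) (hp2 : 0 ≤ p2) (hp3 : 0 ≤ p3) (hp4 : 0 ≤ p4) (hp5 : 0 ≤ p5)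
    (hpsum : p1 + p2 + p3 + p4 + p5 = 1)
    (AD : ℕ → ℝ)
    (hAD : ∀ N, AD N = p1 * A1 N + p2 * A2 N + p3 * A3 N + p4 * A4 N + p5 * A5 N)
    (Nstar : ℕ) (hNstar1 : 1 ≤ Nstar) (hNstar2 : Nstar ≤ Nmax)
    (h1 : ∀ N, 1 ≤ N → N ≤ Nstar → A1 Nstar - A1 N = 0)
    (h2 : ∀ N, 1 ≤ N → N ≤ Nstar → A2 Nstar - A2 N = 0)
    (h5 : ∀ N, 1 ≤ N → N ≤ Nstar → A5 Nstar - A5 N = 0)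
    (h3 : ∀ N, 1 ≤ N → N < Nstar → 0 < -(A3 Nstar - A3 N))
    (h4 : ∀ N, 1 ≤ N → N < Nstar → 0 < A4 Nstar - A4 N)
    (δ : ℝ)
    (hδ : δ = sInf ((fun N => (A4 Nstar - A4 N) / (-(A3 Nstar - A3 N))) ''
        {N : ℕ | 1 ≤ N ∧ N < Nstar}))
    (hδpos : 0 < δ)
    (ND : ℕ) (hND1 : 1 ≤ ND) (hND2 : ND ≤ Nmax)
    (hNDmax : ∀ N, 1 ≤ N → N ≤ Nmax → AD N ≤ AD ND)
    (hNDmin : ∀ N, 1 ≤ N → N ≤ Nmax → AD N = AD ND → ND ≤ N)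
    (N3 N5 : ℝ) (hN3 : 1 ≤ N3 ∧ N3 ≤ (Nmax : ℝ)) (hN5 : 1 ≤ N5 ∧ N5 ≤ (Nmax : ℝ))
    (κ : ℝ) (hκ : κ = N3 + N5 - 1) :
    (p1 * 1 + p2 * 1 + p3 * N3 + p4 * (Nstar : ℝ) + p5 * N5) / (ND : ℝ) ≤
      (κ + p4 * ((Nstar : ℝ) - κ)) /
        (1 + ((Nstar : ℝ) - 1) * (if p4 * δ > 1 - p4 then (1 : ℝ) else 0)) := by
  obtain ⟨hN3, -⟩ := hN3
  obtain ⟨hN5, -⟩ := hN5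
  have hNDpos : (1 : ℝ) ≤ ND := by exact_mod_cast hND1
  have hNs : (1 : ℝ) ≤ Nstar := by exact_mod_cast hNstar1
  have hnum : p1 * 1 + p2 * 1 + p3 * N3 + p4 * (Nstar : ℝ) + p5 * N5 ≤
      κ + p4 * ((Nstar : ℝ) - κ) := by
    have e1 : p1 * 1 ≤ p1 * κ := mul_le_mul_of_nonneg_left (by linarith) hp1
    have e2 : p2 * 1 ≤ p2 * κ := mul_le_mul_of_nonneg_left (by linarith) hp2
    have e3 : p3 * N3 ≤ p3 * κ := mul_le_mul_of_nonneg_left (by linarith) hp3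
    have e5 : p5 * N5 ≤ p5 * κ := mul_le_mul_of_nonneg_left (by linarith) hp5
    have e : p1 * κ + p2 * κ + p3 * κ + p4 * κ + p5 * κ = κ := by
      linear_combination κ * hpsum
    linarith
  have hnum0 : 0 ≤ κ + p4 * ((Nstar : ℝ) - κ) := by
    refine le_trans ?_ hnum
    have : 0 ≤ N3 := by linarith
    have : 0 ≤ N5 := by linarith
    positivity
  split_ifs with h
  · have hle : Nstar ≤ ND := by
      by_contra! hlt
      have h3' := h3 ND hND1 hlt
      have hδle : δ ≤ (A4 Nstar - A4 ND) / (-(A3 Nstar - A3 ND)) := by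
        rw [hδ]
        refine csInf_le ⟨0, ?_⟩ ⟨ND, ⟨hND1, hlt⟩, rfl⟩
        rintro _ ⟨N, ⟨hN, hN'⟩, rfl⟩
        exact (div_pos (h4 N hN hN') (h3 N hN hN')).le
      rw [le_div_iff₀ h3'] at hδle
      have hmax := hNDmax Nstar hNstar1 hNstar2
      rw [hAD, hAD, sub_eq_zero.1 (h1 ND hND1 hlt.le), sub_eq_zero.1 (h2 ND hND1 hlt.le),
        sub_eq_zero.1 (h5 ND hND1 hlt.le)] at hmax
      have hgain := mul_le_mul_of_nonneg_left hδle hp4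
      have hpos : 0 < (p4 * δ - p3) * (-(A3 Nstar - A3 ND)) :=
        mul_pos (by linarith) h3'
      linarith
    have hle' : (Nstar : ℝ) ≤ ND := by exact_mod_cast hle
    exact div_le_div₀ hnum0 hnum (by linarith) (by linarith)
  · exact div_le_div₀ hnum0 hnum (by linarith) (by linarith)
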